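/- arXiv:math/0605564 — 4 statements merged into one kernel-verified Lean document; each statement's English description precedes it below -/
import Mathlib

section
/- Let F, F' be nonempty subsets of [r] with F∖F', F∩F' and F'∖F all nonempty, and let P = Δ_F + Δ_{F'}. Call a vertex e_i + e_j of P of type A if i ∈ F∖F' and j ∈ F∩F', of type B if it equals 2e_j with j ∈ F∩F', of type C if i ∈ F∩F' and j ∈ F'∖F, and of type D if i ∈ F∖F' and j ∈ F'∖F. Then no segment [u,v] with u of type A and v of type C is an edge of P, and no segment [u,v] with u of type B and v of type D is an edge of P. -/
open Pointwise

/-- The standard basis vector `e i` in `ℝ^r`. -/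
noncomputable def eVec (r : ℕ) (i : Fin r) : Fin r → ℝ := Pi.single i 1

/-- The standard simplex `Δ_F ⊆ ℝ^r` supported on a subset `F` of the coordinates. -/
def simpl {r : ℕ} (F : Finset (Fin r)) : Set (Fin r → ℝ) :=
  {x | (∀ i, 0 ≤ x i) ∧ (∀ i, i ∉ F → x i = 0) ∧ ∑ i, x i = 1}

/-- The Minkowski sum `P_𝓕 = Δ_{F 0} + ⋯ + Δ_{F (k-1)}`. -/
noncomputable def mink {r k : ℕ} (F : Fin k → Finset (Fin r)) : Set (Fin r → ℝ) :=
  ∑ j : Fin k, simpl (F j)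

/-- `[u,v]` is an edge of `P`: `u ≠ v` are vertices (extreme points) of `P` and the
segment `[u,v]` is an extreme subset (face) of `P`. -/
def IsEdgeOf {r : ℕ} (P : Set (Fin r → ℝ)) (u v : Fin r → ℝ) : Prop :=
  u ≠ v ∧ u ∈ Set.extremePoints ℝ P ∧ v ∈ Set.extremePoints ℝ P ∧
    IsExtreme ℝ P (segment ℝ u v)

/-- The degree of a vertex `u` of `P`: the number of `v` with `[u,v]` an edge of `P`. -/
noncomputable def polyDeg {r : ℕ} (P : Set (Fin r → ℝ)) (u : Fin r → ℝ) : ℕ :=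
  {v | IsEdgeOf P u v}.ncard

/-- The number of edges of `P`, counted as segments. -/
noncomputable def numEdgesOf {r : ℕ} (P : Set (Fin r → ℝ)) : ℕ :=
  {s : Set (Fin r → ℝ) | ∃ u v, IsEdgeOf P u v ∧ s = segment ℝ u v}.ncard

/-- The point `u(f) = e_{f 0} + ⋯ + e_{f (k-1)}` associated to a rep-function `f`. -/
noncomputable def urep {r k : ℕ} (f : Fin k → Fin r) : Fin r → ℝ :=
  ∑ j, eVec r (f j)

theorem eVec_mem_simpl {r : ℕ} {F : Finset (Fin r)} {i : Fin r} (h : i ∈ F) :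
    eVec r i ∈ simpl F := by
  refine ⟨fun k => ?_, fun k hk => ?_, ?_⟩
  · unfold eVec
    by_cases hki : k = i
    · subst hki; simp
    · simp [Pi.single_eq_of_ne hki]
  · have hki : k ≠ i := fun e => hk (e ▸ h)
    simp [eVec, Pi.single_eq_of_ne hki]
  · simp [eVec]

/-- If two points of `P` have the same midpoint as an edge, they lie on that edge. -/
theorem exists_of_edge {r : ℕ} {P : Set (Fin r → ℝ)} {u v x y : Fin r → ℝ}
    (h : IsEdgeOf P u v) (hx : x ∈ P) (hy : y ∈ P) (hs : x + y = u + v) :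
    ∃ a b : ℝ, a + b = 1 ∧ ∀ k, a * u k + b * v k = x k := by
  obtain ⟨-, -, -, hE⟩ := h
  have hm : (1 / 2 : ℝ) • u + (1 / 2 : ℝ) • v ∈ segment ℝ u v :=
    ⟨1 / 2, 1 / 2, by norm_num, by norm_num, by norm_num, rfl⟩
  have ho : (1 / 2 : ℝ) • u + (1 / 2 : ℝ) • v ∈ openSegment ℝ x y :=
    ⟨1 / 2, 1 / 2, by norm_num, by norm_num, by norm_num, by
      rw [← smul_add, ← smul_add, hs]⟩
  obtain ⟨a, b, -, -, hab, he⟩ := hE.left_mem_of_mem_openSegment hx hy hm ho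
  exact ⟨a, b, hab, fun k => by simpa using congrFun he k⟩

/-- In the Minkowski sum `P = Δ_F + Δ_{F'}` (with `F∖F'`, `F∩F'`, `F'∖F` all nonempty),
no segment from a type-`A` vertex `e i + e j` (`i ∈ F∖F'`, `j ∈ F∩F'`) to a type-`C` vertex
`e i' + e j'` (`i' ∈ F∩F'`, `j' ∈ F'∖F`) is an edge of `P`, and no segment from a type-`B`
vertex `2 e j` (`j ∈ F∩F'`) to a type-`D` vertex `e i' + e j'` (`i' ∈ F∖F'`, `j' ∈ F'∖F`)
is an edge of `P`. -/
theorem no_AC_or_BD_edges {r : ℕ} (F F' : Finset (Fin r))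
    (h1 : (F \ F').Nonempty) (h2 : (F ∩ F').Nonempty) (h3 : (F' \ F).Nonempty) :
    (∀ i ∈ F \ F', ∀ j ∈ F ∩ F', ∀ i' ∈ F ∩ F', ∀ j' ∈ F' \ F,
      ¬ IsEdgeOf (simpl F + simpl F') (eVec r i + eVec r j) (eVec r i' + eVec r j')) ∧
    (∀ j ∈ F ∩ F', ∀ i' ∈ F \ F', ∀ j' ∈ F' \ F,
      ¬ IsEdgeOf (simpl F + simpl F') ((2 : ℝ) • eVec r j) (eVec r i' + eVec r j')) := by
  constructor
  · intro i hi j hj i' hi' j' hj' h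
    simp only [Finset.mem_sdiff, Finset.mem_inter] at hi hj hi' hj'
    obtain ⟨a, b, hab, hk⟩ := exists_of_edge (x := eVec r i + eVec r j')
      (y := eVec r j + eVec r i') h
      (Set.add_mem_add (eVec_mem_simpl hi.1) (eVec_mem_simpl hj'.1))
      (Set.add_mem_add (eVec_mem_simpl hj.1) (eVec_mem_simpl hi'.2)) (by abel)
    have n1 : i ≠ j := fun e => hi.2 (e ▸ hj.2)
    have n2 : i ≠ i' := fun e => hi.2 (e ▸ hi'.2)
    have n3 : i ≠ j' := fun e => hi.2 (e ▸ hj'.1)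
    have n4 : j' ≠ j := fun e => hj'.2 (e ▸ hj.1)
    have n5 : j' ≠ i' := fun e => hj'.2 (e ▸ hi'.1)
    have e1 := hk i
    have e2 := hk j'
    simp [eVec, Pi.single_apply, n1, n2, n3, n3.symm, n4, n5] at e1 e2
    linarith
  · intro j hj i' hi' j' hj' h
    simp only [Finset.mem_sdiff, Finset.mem_inter] at hj hi' hj'
    obtain ⟨a, b, hab, hk⟩ := exists_of_edge (x := eVec r i' + eVec r j)
      (y := eVec r j + eVec r j') h
      (Set.add_mem_add (eVec_mem_simpl hi'.1) (eVec_mem_simpl hj.2))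
      (Set.add_mem_add (eVec_mem_simpl hj.1) (eVec_mem_simpl hj'.1))
      (by rw [two_smul]; abel)
    have n1 : i' ≠ j := fun e => hi'.2 (e ▸ hj.2)
    have n3 : i' ≠ j' := fun e => hi'.2 (e ▸ hj'.1)
    have n4 : j' ≠ j := fun e => hj'.2 (e ▸ hj.1)
    have e1 := hk i'
    have e2 := hk j'
    simp [eVec, Pi.single_apply, n1, n3, n3.symm, n4] at e1 e2
    linarith
end

section
/- Let F, F' be nonempty subsets of [r] and let P = Δ_F + Δ_{F'}. Then the number of vertices (extreme points) of P equals |F|·|F'| − |F∩F'|·(|F∩F'| − 1). -/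
open Pointwise

lemma simpl_max {r : ℕ} {F : Finset (Fin r)} {i : Fin r} (c : Fin r → ℝ)
    (hc : ∀ k ∈ F, k ≠ i → c k < c i) {x : Fin r → ℝ} (hx : x ∈ simpl F) :
    ∑ k, c k * x k ≤ c i ∧ (∑ k, c k * x k = c i → x = eVec r i) := by
  obtain ⟨h0, h1, h2⟩ := hx
  have key : c i - ∑ k, c k * x k = ∑ k, (c i - c k) * x k := by
    simp only [sub_mul, Finset.sum_sub_distrib, ← Finset.mul_sum, h2, mul_one]
  have nn : ∀ k ∈ Finset.univ, 0 ≤ (c i - c k) * x k := by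
    intro k _
    by_cases hk : k ∈ F
    · by_cases hki : k = i
      · simp [hki]
      · exact mul_nonneg (sub_nonneg.2 (hc k hk hki).le) (h0 k)
    · simp [h1 k hk]
  refine ⟨by linarith [Finset.sum_nonneg nn], fun h => ?_⟩
  have hz : ∑ k, (c i - c k) * x k = 0 := by linarith
  rw [Finset.sum_eq_zero_iff_of_nonneg nn] at hz
  have hx0 : ∀ k, k ≠ i → x k = 0 := by
    intro k hki
    by_cases hk : k ∈ F
    · have := hz k (Finset.mem_univ k)
      rcases mul_eq_zero.1 this with h | h
      · linarith [hc k hk hki]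
      · exact h
    · exact h1 k hk
  have hi : x i = 1 := by
    rw [← h2, Finset.sum_eq_single i (fun k _ hk => hx0 k hk) (by simp)]
  funext k
  by_cases hk : k = i
  · subst hk; simp [eVec, hi]
  · simp [eVec, hk, hx0 k hk]

lemma eVec_mem {r : ℕ} {F : Finset (Fin r)} {i : Fin r} (hi : i ∈ F) : eVec r i ∈ simpl F := by
  refine ⟨fun k => ?_, fun k hk => ?_, ?_⟩
  · by_cases h : k = i
    · subst h; simp [eVec]
    · simp [eVec, h]
  · have : k ≠ i := by rintro rfl; exact hk hi
    simp [eVec, this]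
  · simp [eVec]

lemma sum_extreme {r : ℕ} {F F' : Finset (Fin r)} {i j : Fin r} (hi : i ∈ F) (hj : j ∈ F')
    (c : Fin r → ℝ) (hc : ∀ k ∈ F, k ≠ i → c k < c i) (hc' : ∀ k ∈ F', k ≠ j → c k < c j) :
    eVec r i + eVec r j ∈ Set.extremePoints ℝ (simpl F + simpl F') := by
  have hmax : ∀ p ∈ simpl F + simpl F', ∑ k, c k * p k ≤ c i + c j ∧
      (∑ k, c k * p k = c i + c j → p = eVec r i + eVec r j) := by
    rintro p ⟨x, hx, y, hy, rfl⟩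
    have h1 := simpl_max c hc hx
    have h2 := simpl_max c hc' hy
    simp only [Pi.add_apply, mul_add, Finset.sum_add_distrib]
    refine ⟨by linarith, fun h => ?_⟩
    rw [h1.2 (by linarith), h2.2 (by linarith)]
  refine ⟨Set.add_mem_add (eVec_mem hi) (eVec_mem hj), ?_⟩
  rintro p hp q hq ⟨a, b, ha, hb, hab, h⟩
  have e : ∑ k, c k * (eVec r i + eVec r j) k = c i + c j := by
    simp [eVec, mul_add, Finset.sum_add_distrib, Pi.single_apply]
  have e2 : ∑ k, c k * (a • p + b • q) k = a * ∑ k, c k * p k + b * ∑ k, c k * q k := by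
    rw [Finset.mul_sum, Finset.mul_sum, ← Finset.sum_add_distrib]
    refine Finset.sum_congr rfl fun k _ => ?_
    simp only [Pi.add_apply, Pi.smul_apply, smul_eq_mul]; ring
  rw [h, e] at e2
  have hp' := hmax p hp
  have hq' := hmax q hq
  apply hp'.2
  refine le_antisymm hp'.1 ?_
  have hb' : b = 1 - a := by linarith
  subst hb'
  have := mul_le_mul_of_nonneg_left hq'.1 hb.le
  by_contra hlt
  have := mul_lt_mul_of_pos_left (not_le.1 hlt) ha
  nlinarith

lemma simpl_hull {r : ℕ} (F : Finset (Fin r)) :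
    simpl F = convexHull ℝ (eVec r '' (F : Set (Fin r))) := by
  apply Set.Subset.antisymm
  · rintro x ⟨h0, h1, h2⟩
    have hs : ∑ k ∈ F, x k = 1 := by
      rw [← h2]
      exact Finset.sum_subset (Finset.subset_univ _) fun k _ hk => h1 k hk
    have hx : x = ∑ k ∈ F, x k • eVec r k := by
      funext l
      simp only [Finset.sum_apply, Pi.smul_apply, eVec, Pi.single_apply, smul_eq_mul, mul_ite,
        mul_one, mul_zero, Finset.sum_ite_eq]
      split_ifs with h
      · rfl
      · exact h1 l h
    rw [hx]
    exact (convex_convexHull ℝ _).sum_mem (fun k _ => h0 k) hs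
      (fun k hk => subset_convexHull ℝ _ ⟨k, hk, rfl⟩)
  · apply convexHull_min
    · rintro _ ⟨k, hk, rfl⟩
      exact eVec_mem hk
    · rintro x ⟨h0, h1, h2⟩ y ⟨k0, k1, k2⟩ a b ha hb hab
      refine ⟨fun i => ?_, fun i hi => ?_, ?_⟩
      · have := mul_nonneg ha (h0 i)
        have := mul_nonneg hb (k0 i)
        simp only [Pi.add_apply, Pi.smul_apply, smul_eq_mul]; linarith
      · simp [h1 i hi, k1 i hi]
      · simp [Finset.sum_add_distrib, ← Finset.mul_sum, h2, k2, hab]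

lemma eVec_add_inj {r : ℕ} {i j k l : Fin r} (h : eVec r i + eVec r j = eVec r k + eVec r l) :
    (i = k ∧ j = l) ∨ (i = l ∧ j = k) := by
  have h1 := congrFun h i
  have h2 := congrFun h j
  have h3 := congrFun h k
  have h4 := congrFun h l
  simp only [eVec, Pi.add_apply, Pi.single_apply] at h1 h2 h3 h4
  grind

lemma extreme_eq {r : ℕ} (F F' : Finset (Fin r)) :
    Set.extremePoints ℝ (simpl F + simpl F') =
      (fun p : Fin r × Fin r => eVec r p.1 + eVec r p.2) ''
        (((F ×ˢ F') \ (F ∩ F').offDiag : Finset (Fin r × Fin r)) : Set (Fin r × Fin r)) := by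
  apply Set.Subset.antisymm
  · intro z hz
    have hz' := hz
    rw [simpl_hull F, simpl_hull F', ← convexHull_add] at hz'
    obtain ⟨_, ⟨i, hi, rfl⟩, _, ⟨j, hj, rfl⟩, rfl⟩ := extremePoints_convexHull_subset hz'
    have hi' : i ∈ F := hi
    have hj' : j ∈ F' := hj
    refine ⟨(i, j), ?_, rfl⟩
    simp only [Finset.mem_coe, Finset.mem_sdiff, Finset.mem_product, Finset.mem_offDiag,
      Finset.mem_inter]
    refine ⟨⟨hi', hj'⟩, ?_⟩
    rintro ⟨⟨_, hi2⟩, ⟨hj2, _⟩, hne⟩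
    have := hz.2 (Set.add_mem_add (eVec_mem hi') (eVec_mem hi2))
      (Set.add_mem_add (eVec_mem hj2) (eVec_mem hj'))
      ⟨1/2, 1/2, by norm_num, by norm_num, by norm_num, by
        funext k
        simp only [Pi.add_apply, Pi.smul_apply, smul_eq_mul]; ring⟩
    rcases eVec_add_inj this with h | h
    · exact hne h.2
    · exact hne h.1
  · rintro _ ⟨⟨i, j⟩, h, rfl⟩
    simp only [Finset.mem_coe, Finset.mem_sdiff, Finset.mem_product, Finset.mem_offDiag,
      Finset.mem_inter] at h
    obtain ⟨⟨hi, hj⟩, hn⟩ := h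
    by_cases hij : i = j
    · subst hij
      refine sum_extreme hi hj (fun k => if k = i then 1 else 0) ?_ ?_ <;>
      · intro k _ hk
        simp [hk]
    · by_cases hjF : j ∈ F
      · have hiF : i ∉ F' := fun h => hn ⟨⟨hi, h⟩, ⟨hjF, hj⟩, hij⟩
        refine sum_extreme hi hj (fun k => if k = i then 2 else if k = j then 1 else 0) ?_ ?_ <;>
        · intro k hk hne
          have hji : j ≠ i := Ne.symm hij
          have : k = i → k ∉ F' := by rintro rfl; exact hiF
          grind
      · refine sum_extreme hi hj (fun k => if k = j then 2 else if k = i then 1 else 0) ?_ ?_ <;>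
        · intro k hk hne
          have : k = j → k ∉ F := by rintro rfl; exact hjF
          grind

/-- The number of vertices (extreme points) of `P = Δ_F + Δ_{F'}` is
`|F|·|F'| − |F∩F'|·(|F∩F'| − 1)`. -/
theorem card_vertices_sum_of_two {r : ℕ} (F F' : Finset (Fin r))
    (hF : F.Nonempty) (hF' : F'.Nonempty) :
    (Set.extremePoints ℝ (simpl F + simpl F')).ncard =
      F.card * F'.card - (F ∩ F').card * ((F ∩ F').card - 1) := by
  rw [extreme_eq, Set.InjOn.ncard_image, Set.ncard_coe_finset, Finset.card_sdiff_of_subset,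
    Finset.card_product, Finset.offDiag_card, Nat.mul_sub, mul_one]
  · rintro ⟨i, j⟩ h
    simp only [Finset.mem_product, Finset.mem_offDiag, Finset.mem_inter] at h ⊢
    exact ⟨h.1.1, h.2.1.2⟩
  · rintro ⟨i, j⟩ h ⟨k, l⟩ h' heq
    simp only [Finset.mem_coe, Finset.mem_sdiff, Finset.mem_product, Finset.mem_offDiag,
      Finset.mem_inter] at h h'
    rcases eVec_add_inj heq with ⟨rfl, rfl⟩ | ⟨rfl, rfl⟩
    · rfl
    · have : i = j := by
        by_contra hne
        exact h.2 ⟨⟨h.1.1, h'.1.2⟩, ⟨h'.1.1, h.1.2⟩, hne⟩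
      rw [this]
end

section
/- Let 𝓕 = (F_1,…,F_k) be a finite family of nonempty subsets of [r] and let v ∈ P_𝓕 have all coordinates integers. Then v is a vertex (extreme point) of P_𝓕 if and only if there is exactly one rep-function f for 𝓕 with u(f) = v. -/
open Pointwise

theorem memMinkAux {r k : ℕ} (F : Fin k → Finset (Fin r)) (v : Fin r → ℝ) :
    v ∈ mink F ↔ ∃ x : Fin k → Fin r → ℝ, (∀ j, x j ∈ simpl (F j)) ∧ ∑ j, x j = v := by
  unfold mink
  rw [Set.mem_fintype_sum]
  constructor
  · rintro ⟨g, hg, h⟩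
    exact ⟨g, hg, h⟩
  · rintro ⟨g, hg, h⟩
    exact ⟨g, hg, h⟩

theorem eVecMemAux {r : ℕ} (F : Finset (Fin r)) (i : Fin r) (hi : i ∈ F) :
    eVec r i ∈ simpl F := by
  refine ⟨fun l => ?_, fun l hl => ?_, ?_⟩
  · unfold eVec
    rw [Pi.single_apply]
    split_ifs <;> norm_num
  · unfold eVec
    rw [Pi.single_apply, if_neg]
    rintro rfl
    exact hl hi
  · simp [eVec]

theorem urepMemAux {r k : ℕ} (F : Fin k → Finset (Fin r)) (f : Fin k → Fin r)
    (hf : ∀ j, f j ∈ F j) : urep f ∈ mink F := by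
  rw [memMinkAux]
  exact ⟨fun j => eVec r (f j), fun j => eVecMemAux _ _ (hf j), rfl⟩

/-- Birkhoff: every positive entry of a decomposition is used by some rep-function. -/
theorem birkhoffAux {r k : ℕ} (F : Fin k → Finset (Fin r)) (v : Fin r → ℝ)
    (hint : ∀ i, ∃ n : ℤ, v i = n) (x : Fin k → Fin r → ℝ)
    (hx : ∀ j, x j ∈ simpl (F j)) (hs : ∑ j, x j = v) (j : Fin k) (i : Fin r)
    (hpos : 0 < x j i) :
    ∃ g : Fin k → Fin r, g j = i ∧ (∀ j, g j ∈ F j) ∧ urep g = v := by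
  have hvs : ∀ i, ∑ j, x j i = v i := by
    intro i
    rw [← hs, Finset.sum_apply]
  have hnat : ∀ i, ∃ n : ℕ, v i = n := by
    intro i
    obtain ⟨z, hz⟩ := hint i
    have h0 : 0 ≤ v i := by
      rw [← hvs i]
      exact Finset.sum_nonneg fun j _ => (hx j).1 i
    have hz0 : 0 ≤ z := by
      rw [hz] at h0
      exact_mod_cast h0
    lift z to ℕ using hz0
    exact ⟨z, by simpa using hz⟩
  choose n hn using hnat
  have hz : ∀ j i, n i = 0 → x j i = 0 := by
    intro j i h
    have h1 := hvs i
    rw [hn i, h, Nat.cast_zero, Finset.sum_eq_zero_iff_of_nonneg (fun j _ => (hx j).1 i)] at h1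
    exact h1 j (Finset.mem_univ _)
  have hcard : ∑ i, n i = k := by
    have h : ((∑ i, n i : ℕ) : ℝ) = k := by
      push_cast
      simp_rw [← hn, ← hvs]
      rw [Finset.sum_comm]
      simp [fun j => (hx j).2.2]
    exact_mod_cast h
  have e : Fin k ≃ (Σ i : Fin r, Fin (n i)) :=
    Fintype.equivOfCardEq (by simp [hcard])
  let D : Matrix (Fin k) (Fin k) ℝ := fun j m => x j (e m).1 / n (e m).1
  have hD : D ∈ doublyStochastic ℝ (Fin k) := by
    rw [mem_doublyStochastic_iff_sum]
    refine ⟨fun j m => div_nonneg ((hx j).1 _) (Nat.cast_nonneg _), fun j => ?_, fun m => ?_⟩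
    · change ∑ m, x j (e m).1 / n (e m).1 = 1
      rw [e.sum_comp (fun p => x j p.1 / n p.1), Fintype.sum_sigma, ← (hx j).2.2]
      refine Finset.sum_congr rfl fun i _ => ?_
      by_cases h : n i = 0
      · simp [hz j i h]
      · have : (n i : ℝ) ≠ 0 := by exact_mod_cast h
        simp
        field_simp
    · change ∑ j, x j (e m).1 / n (e m).1 = 1
      rw [← Finset.sum_div, hvs, hn, div_self]
      have := (e m).2.pos
      exact_mod_cast this.ne'
  obtain ⟨w, hw, -, hwD⟩ := exists_eq_sum_perm_of_mem_doublyStochastic hD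
  have hent : ∀ a b, D a b = ∑ σ : Equiv.Perm (Fin k), w σ * (if σ a = b then 1 else 0) := by
    intro a b
    rw [← hwD, Matrix.sum_apply]
    refine Finset.sum_congr rfl fun σ _ => ?_
    simp [Equiv.Perm.permMatrix, PEquiv.toMatrix_apply, eq_comm]
  have hni : 0 < n i := by
    rcases Nat.eq_zero_or_pos (n i) with h | h
    · rw [hz j i h] at hpos
      exact absurd hpos (lt_irrefl _)
    · exact h
  obtain ⟨m, hm⟩ : ∃ m, (e m).1 = i := ⟨e.symm ⟨i, ⟨0, hni⟩⟩, by simp⟩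
  have hDp : 0 < D j m := by
    change 0 < x j (e m).1 / n (e m).1
    rw [hm]
    exact div_pos hpos (by exact_mod_cast hni)
  rw [hent] at hDp
  obtain ⟨σ, -, hσ⟩ := Finset.exists_lt_of_sum_lt
    (s := Finset.univ) (f := fun _ : Equiv.Perm (Fin k) => (0 : ℝ)) (by simpa using hDp)
  have hσm : σ j = m := by
    by_contra h
    simp [h] at hσ
  have hwσ : 0 < w σ := by simpa [hσm] using hσ
  refine ⟨fun a => (e (σ a)).1, by simp [hσm, hm], fun a => ?_, ?_⟩
  · by_contra h
    have h0 : D a (σ a) = 0 := by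
      change x a (e (σ a)).1 / n (e (σ a)).1 = 0
      rw [(hx a).2.1 _ h, zero_div]
    have h1 : w σ * (if σ a = σ a then 1 else 0) ≤ D a (σ a) := by
      rw [hent]
      exact Finset.single_le_sum (f := fun τ : Equiv.Perm (Fin k) =>
        w τ * (if τ a = σ a then 1 else 0))
        (fun τ _ => mul_nonneg (hw τ) (by split_ifs <;> norm_num)) (Finset.mem_univ σ)
    simp at h1
    linarith
  · unfold urep
    rw [Equiv.sum_comp σ (fun b => eVec r (e b).1), e.sum_comp (fun p => eVec r p.1),
      Fintype.sum_sigma]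
    ext l
    simp [eVec, Finset.sum_apply, Pi.single_apply, hn]

theorem urepUpdateAux {r k : ℕ} (f : Fin k → Fin r) (j : Fin k) (i : Fin r) :
    urep (Function.update f j i) = urep f - eVec r (f j) + eVec r i := by
  unfold urep
  rw [← Finset.add_sum_erase _ _ (Finset.mem_univ j),
    ← Finset.add_sum_erase Finset.univ (fun j => eVec r (f j)) (Finset.mem_univ j)]
  have : ∑ a ∈ Finset.univ.erase j, eVec r (Function.update f j i a)
      = ∑ a ∈ Finset.univ.erase j, eVec r (f a) := by
    refine Finset.sum_congr rfl fun a ha => ?_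
    rw [Function.update_of_ne (Finset.ne_of_mem_erase ha)]
  rw [this, Function.update_self]
  abel

theorem updMemAux {r k : ℕ} (F : Fin k → Finset (Fin r)) (f : Fin k → Fin r)
    (hf : ∀ j, f j ∈ F j) (j : Fin k) (i : Fin r) (hi : i ∈ F j) :
    ∀ a, Function.update f j i a ∈ F a := by
  intro a
  by_cases h : a = j
  · subst h
    simpa using hi
  · rw [Function.update_of_ne h]
    exact hf a

theorem eqEVecAux {r : ℕ} (F : Finset (Fin r)) (y : Fin r → ℝ) (hy : y ∈ simpl F) (i : Fin r)
    (h : ∀ l, l ≠ i → y l = 0) : y = eVec r i := by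
  have h1 : y i = 1 := by
    rw [← hy.2.2]
    exact (Finset.sum_eq_single i (fun l _ hl => h l hl) (by simp)).symm
  ext l
  unfold eVec
  rw [Pi.single_apply]
  split_ifs with hl
  · rw [hl, h1]
  · exact h l hl

/-- An integer point `v` of `P_𝓕` is a vertex of `P_𝓕` iff there is exactly one
rep-function `f` with `u(f) = v`. -/
theorem vertex_iff_unique_rep_function {r k : ℕ} (F : Fin k → Finset (Fin r))
    (hF : ∀ j, (F j).Nonempty) (v : Fin r → ℝ) (hv : v ∈ mink F)
    (hint : ∀ i, ∃ n : ℤ, v i = n) :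
    v ∈ Set.extremePoints ℝ (mink F) ↔
      ∃! f : Fin k → Fin r, (∀ j, f j ∈ F j) ∧ urep f = v := by
  constructor
  · intro hext
    have hex : ∃ f : Fin k → Fin r, (∀ j, f j ∈ F j) ∧ urep f = v := by
      obtain ⟨x, hx, hs⟩ := (memMinkAux F v).1 hv
      rcases Nat.eq_zero_or_pos k with hk | hk
      · subst hk
        refine ⟨fun j => j.elim0, fun j => j.elim0, ?_⟩
        rw [← hs]
        simp [urep]
      · have : ∃ i, 0 < x ⟨0, hk⟩ i := by
          by_contra! h
          have h1 := (hx ⟨0, hk⟩).2.2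
          have h2 := Finset.sum_nonpos (s := Finset.univ) fun i _ => h i
          linarith
        obtain ⟨i, hi⟩ := this
        obtain ⟨g, -, hg⟩ := birkhoffAux F v hint x hx hs _ i hi
        exact ⟨g, hg⟩
    obtain ⟨f, hf, hfv⟩ := hex
    refine ⟨f, ⟨hf, hfv⟩, ?_⟩
    rintro g ⟨hg, hgv⟩
    ext1 j
    by_contra hne
    have ha := urepMemAux F _ (updMemAux F f hf j (g j) (hg j))
    have hb := urepMemAux F _ (updMemAux F g hg j (f j) (hf j))
    have hseg : v ∈ openSegment ℝ (urep (Function.update f j (g j)))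
        (urep (Function.update g j (f j))) := by
      refine ⟨1 / 2, 1 / 2, by norm_num, by norm_num, by norm_num, ?_⟩
      rw [urepUpdateAux, urepUpdateAux, hfv, hgv]
      module
    have heq := hext.2 ha hb hseg
    rw [urepUpdateAux, hfv] at heq
    have h2 := congrFun heq (g j)
    simp [eVec, Pi.single_apply, hne] at h2
  · rintro ⟨f, ⟨hf, hfv⟩, huniq⟩
    refine ⟨hv, ?_⟩
    rintro a ha b hb ⟨s, t, hs, ht, hst, hab⟩
    obtain ⟨x, hx, hxa⟩ := (memMinkAux F a).1 ha
    obtain ⟨y, hy, hyb⟩ := (memMinkAux F b).1 hb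
    have hz : ∀ j, s • x j + t • y j ∈ simpl (F j) := by
      intro j
      refine ⟨fun i => ?_, fun i hi => ?_, ?_⟩
      · have := mul_nonneg hs.le ((hx j).1 i)
        have := mul_nonneg ht.le ((hy j).1 i)
        simp only [Pi.add_apply, Pi.smul_apply, smul_eq_mul]
        linarith
      · simp [(hx j).2.1 i hi, (hy j).2.1 i hi]
      · simp only [Pi.add_apply, Pi.smul_apply, smul_eq_mul]
        rw [Finset.sum_add_distrib, ← Finset.mul_sum, ← Finset.mul_sum, (hx j).2.2, (hy j).2.2]
        linarith
    have hzs : ∑ j, (s • x j + t • y j) = v := by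
      rw [Finset.sum_add_distrib, ← Finset.smul_sum, ← Finset.smul_sum, hxa, hyb, hab]
    have hxe : ∀ j, x j = eVec r (f j) := by
      intro j
      refine eqEVecAux (F j) _ (hx j) _ fun l hl => ?_
      by_contra h
      have hp : 0 < x j l := lt_of_le_of_ne ((hx j).1 l) (Ne.symm h)
      obtain ⟨g, hgj, hg⟩ := birkhoffAux F v hint _ hz hzs j l (by
        have := mul_pos hs hp
        have := mul_nonneg ht.le ((hy j).1 l)
        simp only [Pi.add_apply, Pi.smul_apply, smul_eq_mul]
        linarith)
      rw [huniq g hg] at hgj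
      exact hl hgj.symm
    rw [← hxa, ← hfv]
    exact Finset.sum_congr rfl fun j _ => hxe j
end

section
/- Let 𝓕 = (F_1,…,F_k) be any finite family of nonempty subsets of [r]. Then every vertex u of P_𝓕 has degree at most ⌊r²/4⌋, i.e. the number of vertices v such that [u,v] is an edge of P_𝓕 is at most ⌊r²/4⌋. -/
open Pointwise

lemma aux_ext2 {r : ℕ} {P : Set (Fin r → ℝ)} {u p q : Fin r → ℝ}
    (hu : u ∈ Set.extremePoints ℝ P) (hp : p ∈ P) (hq : q ∈ P) {α β : ℝ} (hα : 0 < α) (hβ : 0 < β)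
    (h : α • (p - u) + β • (q - u) = 0) : p = u := by
  refine hu.2 hp hq ⟨α / (α + β), β / (α + β), by positivity, by positivity, by field_simp, ?_⟩
  ext i
  have := congrFun h i
  simp only [Pi.add_apply, Pi.smul_apply, Pi.sub_apply, Pi.zero_apply, smul_eq_mul] at this ⊢
  field_simp
  linarith

lemma aux_mid {r : ℕ} {P : Set (Fin r → ℝ)} (hP : Convex ℝ P) {p q : Fin r → ℝ}
    (hp : p ∈ P) (hq : q ∈ P) {α β : ℝ} (hα : 0 < α) (hβ : 0 < β) :
    (α / (α + β)) • p + (β / (α + β)) • q ∈ P :=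
  hP hp hq (by positivity) (by positivity) (by field_simp)

lemma aux_ext3 {r : ℕ} {P : Set (Fin r → ℝ)} (hP : Convex ℝ P) {u p q s : Fin r → ℝ}
    (hu : u ∈ Set.extremePoints ℝ P) (hp : p ∈ P) (hq : q ∈ P) (hs : s ∈ P)
    {α β γ : ℝ} (hα : 0 < α) (hβ : 0 < β) (hγ : 0 < γ)
    (h : α • (p - u) + β • (q - u) + γ • (s - u) = 0) : p = u := by
  refine aux_ext2 hu hp (aux_mid hP hq hs hβ hγ) hα (add_pos hβ hγ) ?_
  ext i
  have := congrFun h i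
  simp only [Pi.add_apply, Pi.smul_apply, Pi.sub_apply, Pi.zero_apply, smul_eq_mul] at this ⊢
  field_simp
  linarith

lemma aux_trans {r : ℕ} {P : Set (Fin r → ℝ)} (hP : Convex ℝ P) {u v p q : Fin r → ℝ}
    (he : IsEdgeOf P u v) (hp : p ∈ P) (hq : q ∈ P) {α β : ℝ} (hα : 0 < α) (hβ : 0 < β)
    (h : v - u = α • (p - u) + β • (q - u)) : p ∈ segment ℝ u v := by
  obtain ⟨hne, hu, hv, hs⟩ := he
  have hm := aux_mid hP hp hq hα hβ
  rcases lt_or_ge (α + β) 1 with h1 | h1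
  · exfalso
    apply hne
    refine hv.2 hu.1 hm ⟨1 - (α + β), α + β, by linarith, by positivity, by ring, ?_⟩
    ext i
    have := congrFun h i
    simp only [Pi.add_apply, Pi.smul_apply, Pi.sub_apply, smul_eq_mul] at this ⊢
    field_simp
    linarith
  · refine hs.left_mem_of_mem_openSegment hp hq (z := (α / (α + β)) • p + (β / (α + β)) • q) ?_
      ⟨α / (α + β), β / (α + β), by positivity, by positivity, by field_simp, rfl⟩
    have h2 : 0 < α + β := by positivity
    refine ⟨1 - 1 / (α + β), 1 / (α + β), ?_, by positivity, by ring, ?_⟩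
    · rw [sub_nonneg, div_le_one h2]; exact h1
    ext i
    have := congrFun h i
    simp only [Pi.add_apply, Pi.smul_apply, Pi.sub_apply, smul_eq_mul] at this ⊢
    field_simp
    linarith

lemma aux_same {r : ℕ} {P : Set (Fin r → ℝ)} {u v w d : Fin r → ℝ}
    (hu : u ∈ P) (hne : u ≠ v) (hv : v ∈ Set.extremePoints ℝ P) (hw : w ∈ P) {s t : ℝ}
    (hs : 0 < s) (h1 : v - u = s • d) (h2 : w - u = t • d) : t ≤ s := by
  by_contra! hst
  apply hne
  have ht : 0 < t := hs.trans hst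
  refine hv.2 hu hw ⟨1 - s / t, s / t, ?_, by positivity, by ring, ?_⟩
  · rw [sub_pos, div_lt_one ht]; exact hst
  · have e1 : v = u + s • d := by rw [← h1]; abel
    have e2 : w = u + t • d := by rw [← h2]; abel
    rw [e1, e2]
    ext i
    simp only [Pi.add_apply, Pi.smul_apply, smul_eq_mul]
    field_simp
    ring

lemma aux_convex_simpl {r : ℕ} (F : Finset (Fin r)) : Convex ℝ (simpl F) := by
  rintro x ⟨hx1, hx2, hx3⟩ y ⟨hy1, hy2, hy3⟩ a b ha hb hab
  refine ⟨fun i => ?_, fun i hi => ?_, ?_⟩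
  · have := hx1 i
    have := hy1 i
    simp only [Pi.add_apply, Pi.smul_apply, smul_eq_mul]
    positivity
  · simp [hx2 i hi, hy2 i hi]
  · simp [Finset.sum_add_distrib, ← Finset.mul_sum, hx3, hy3, hab]

lemma aux_convex_mink {r k : ℕ} (F : Fin k → Finset (Fin r)) : Convex ℝ (mink F) := by
  unfold mink
  exact convex_sum _ fun j _ => aux_convex_simpl (F j)

lemma aux_extreme_simpl {r : ℕ} {F : Finset (Fin r)} {x : Fin r → ℝ}
    (hx : x ∈ Set.extremePoints ℝ (simpl F)) : ∃ a, x = eVec r a := by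
  obtain ⟨⟨h0, hF, h1⟩, hext⟩ := hx
  have : ∃ a, 0 < x a := by
    by_contra! hcon
    have := Finset.sum_nonpos (s := Finset.univ) (fun i _ => hcon i)
    linarith
  obtain ⟨a, ha⟩ := this
  refine ⟨a, ?_⟩
  have haF : a ∈ F := by
    by_contra h
    have := hF a h
    linarith
  have hsplit : x a + ∑ i ∈ Finset.univ.erase a, x i = 1 := by
    rw [Finset.add_sum_erase _ _ (Finset.mem_univ a), h1]
  have hnn : 0 ≤ ∑ i ∈ Finset.univ.erase a, x i := Finset.sum_nonneg fun i _ => h0 i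
  rcases eq_or_lt_of_le hnn with h | h
  · have hz := (Finset.sum_eq_zero_iff_of_nonneg (fun i _ => h0 i)).1 h.symm
    ext i
    by_cases hi : i = a
    · subst hi
      simp [eVec]; linarith
    · simp [eVec, hi, hz i (by simp [hi])]
  · have hlt : 0 < 1 - x a := by linarith
    symm
    refine hext (x₂ := (1 - x a)⁻¹ • (x - x a • eVec r a)) ?_ ?_
      ⟨x a, 1 - x a, ha, hlt, by ring, ?_⟩
    · refine ⟨fun i => ?_, fun i hi => ?_, ?_⟩
      · by_cases hi : i = a
        · subst hi; simp [eVec]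
        · simp [eVec, hi]
      · have : i ≠ a := fun h => hi (h ▸ haF)
        simp [eVec, this]
      · simp [eVec]
    · refine ⟨fun i => ?_, fun i hi => ?_, ?_⟩
      · by_cases hi : i = a
        · subst hi; simp [eVec]
        · have := h0 i
          simp [eVec, hi]
          positivity
      · have : i ≠ a := fun h => hi (h ▸ haF)
        simp [eVec, this, hF i hi]
      · have : ∑ i, eVec r a i = 1 := by simp [eVec]
        simp only [Pi.smul_apply, Pi.sub_apply, smul_eq_mul, ← Finset.mul_sum,
          Finset.sum_sub_distrib, h1, this, mul_one]
        field_simp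
    · rw [smul_smul, mul_inv_cancel₀ hlt.ne', one_smul]
      abel

lemma aux_replace {r k : ℕ} {F : Fin k → Finset (Fin r)} {x : Fin k → Fin r → ℝ}
    (hx : ∀ j, x j ∈ simpl (F j)) (j : Fin k) {p : Fin r → ℝ} (hp : p ∈ simpl (F j)) :
    ∑ i, x i - x j + p ∈ mink F := by
  unfold mink
  rw [Set.mem_fintype_sum]
  refine ⟨Function.update x j p, fun i => ?_, ?_⟩
  · by_cases h : i = j
    · subst h; simpa using hp
    · simpa [h] using hx i
  · rw [← Finset.add_sum_erase _ _ (Finset.mem_univ j),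
      ← Finset.add_sum_erase _ x (Finset.mem_univ j)]
    rw [Finset.sum_congr rfl (g := x)]
    · simp; abel
    · intro i hi
      simp [Finset.ne_of_mem_erase hi]

lemma aux_ext_comp {r k : ℕ} {F : Fin k → Finset (Fin r)} {x : Fin k → Fin r → ℝ}
    (hx : ∀ j, x j ∈ simpl (F j)) (hu : ∑ i, x i ∈ Set.extremePoints ℝ (mink F)) (j : Fin k) :
    ∃ a, x j = eVec r a := by
  apply aux_extreme_simpl (F := F j)
  refine ⟨hx j, ?_⟩
  rintro p hp q hq ⟨a, b, ha, hb, hab, h⟩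
  have := hu.2 (aux_replace hx j hp) (aux_replace hx j hq) ⟨a, b, ha, hb, hab, ?_⟩
  · have h2 : p - x j = 0 := by
      have h3 := sub_eq_zero.2 this
      rw [← h3]; abel
    exact sub_eq_zero.1 h2
  · rw [← h]
    have hb' : b = 1 - a := by linarith
    subst hb'
    ext i
    simp only [Pi.add_apply, Pi.smul_apply, Pi.sub_apply, smul_eq_mul]
    ring

lemma aux_dir {r k : ℕ} {F : Fin k → Finset (Fin r)} {u v : Fin r → ℝ}
    (he : IsEdgeOf (mink F) u v) :
    ∃ a b, a ≠ b ∧ ∃ t : ℝ, 0 < t ∧ v - u = t • (eVec r b - eVec r a) := by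
  obtain ⟨hne, hu, hv, hs⟩ := he
  have hu1 := hu.1
  have hv1 := hv.1
  unfold mink at hu1 hv1
  rw [Set.mem_fintype_sum] at hu1 hv1
  obtain ⟨x, hx, rfl⟩ := hu1
  obtain ⟨y, hy, rfl⟩ := hv1
  have : ∃ j, x j ≠ y j := by
    by_contra! h
    exact hne (by rw [funext h])
  obtain ⟨j, hj⟩ := this
  obtain ⟨a, ha⟩ := aux_ext_comp hx hu j
  obtain ⟨b, hb⟩ := aux_ext_comp hy hv j
  have hmem := hs.left_mem_of_mem_openSegment (aux_replace hx j (hy j)) (aux_replace hy j (hx j))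
    (z := (1 / 2 : ℝ) • ∑ i, x i + (1 / 2 : ℝ) • ∑ i, y i)
    ⟨1 / 2, 1 / 2, by norm_num, by norm_num, by norm_num, rfl⟩
    ⟨1 / 2, 1 / 2, by norm_num, by norm_num, by norm_num, by
      rw [← smul_add, ← smul_add]; congr 1; abel⟩
  obtain ⟨c, s, hc, hs0, hcs, h⟩ := hmem
  have key : y j - x j = s • (∑ i, y i - ∑ i, x i) := by
    have hc' : c = 1 - s := by linarith
    subst hc'
    have : y j - x j = (∑ i, x i - x j + y j) - ∑ i, x i := by abel
    rw [this, ← h]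
    module
  have hs1 : s ≠ 0 := by
    rintro rfl
    rw [zero_smul, sub_eq_zero] at key
    exact hj key.symm
  refine ⟨a, b, ?_, s⁻¹, by positivity, ?_⟩
  · rintro rfl
    exact hj (ha.trans hb.symm)
  · rw [← ha, ← hb, key, smul_smul, inv_mul_cancel₀ hs1, one_smul]

/-- There is an edge at `u` in direction `e_b - e_a`. -/
def AuxDir {r : ℕ} (P : Set (Fin r → ℝ)) (u : Fin r → ℝ) (a b : Fin r) : Prop :=
  ∃ v, IsEdgeOf P u v ∧ ∃ t : ℝ, 0 < t ∧ v - u = t • (eVec r b - eVec r a)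

lemma aux_cyc2 {r : ℕ} {P : Set (Fin r → ℝ)} {u : Fin r → ℝ} {a b : Fin r}
    (h1 : AuxDir P u a b) (h2 : AuxDir P u b a) : False := by
  obtain ⟨v, hv, s, hs, e1⟩ := h1
  obtain ⟨w, hw, t, ht, e2⟩ := h2
  refine hv.1 (aux_ext2 hv.2.1 hv.2.2.1.1 hw.2.2.1.1 (inv_pos.2 hs) (inv_pos.2 ht) ?_).symm
  rw [e1, e2, smul_smul, smul_smul, inv_mul_cancel₀ hs.ne', inv_mul_cancel₀ ht.ne']
  module

lemma aux_cyc3 {r : ℕ} {P : Set (Fin r → ℝ)} (hP : Convex ℝ P) {u : Fin r → ℝ} {a b c : Fin r}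
    (h1 : AuxDir P u a b) (h2 : AuxDir P u b c) (h3 : AuxDir P u c a) : False := by
  obtain ⟨v, hv, s, hs, e1⟩ := h1
  obtain ⟨w, hw, t, ht, e2⟩ := h2
  obtain ⟨z, hz, q, hq, e3⟩ := h3
  refine hv.1 (aux_ext3 hP hv.2.1 hv.2.2.1.1 hw.2.2.1.1 hz.2.2.1.1 (inv_pos.2 hs) (inv_pos.2 ht)
    (inv_pos.2 hq) ?_).symm
  rw [e1, e2, e3, smul_smul, smul_smul, smul_smul, inv_mul_cancel₀ hs.ne', inv_mul_cancel₀ ht.ne',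
    inv_mul_cancel₀ hq.ne']
  module

lemma aux_tri {r : ℕ} {P : Set (Fin r → ℝ)} (hP : Convex ℝ P) {u : Fin r → ℝ} {a b c : Fin r}
    (hab : a ≠ b) (hbc : b ≠ c)
    (h1 : AuxDir P u a b) (h2 : AuxDir P u b c) (h3 : AuxDir P u a c) : False := by
  obtain ⟨v, hv, s, hs, e1⟩ := h1
  obtain ⟨w, hw, t, ht, e2⟩ := h2
  obtain ⟨z, hz, q, hq, e3⟩ := h3
  obtain ⟨x, y, hx, hy, hxy, h⟩ := aux_trans hP hz hv.2.2.1.1 hw.2.2.1.1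
    (α := q * s⁻¹) (β := q * t⁻¹) (by positivity) (by positivity) (by
      rw [e1, e2, e3, smul_smul, smul_smul, mul_assoc, mul_assoc, inv_mul_cancel₀ hs.ne',
        inv_mul_cancel₀ ht.ne']
      module)
  have hx' : x = 1 - y := by linarith
  subst hx'
  have h4 : v - u = y • (z - u) := by rw [← h]; module
  rw [e1, e3] at h4
  have := congrFun h4 b
  simp [eVec, hab.symm, hbc] at this
  exact hs.ne' this

lemma aux_mantel {r : ℕ} (G : SimpleGraph (Fin r)) (hG : G.CliqueFree 3) :
    G.edgeSet.ncard ≤ r ^ 2 / 4 := by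
  classical
  have h := hG.card_edgeFinset_le
  rw [← SimpleGraph.coe_edgeFinset, Set.ncard_coe_finset]
  simp only [Fintype.card_fin] at h
  rcases Nat.mod_two_eq_zero_or_one r with h2 | h2 <;> simp [h2] at h <;> omega

/-- Every vertex of `P_𝓕` has degree at most `⌊r²/4⌋`. -/
theorem degree_le_r_sq_div_four {r k : ℕ} (F : Fin k → Finset (Fin r))
    (hF : ∀ j, (F j).Nonempty) (u : Fin r → ℝ)
    (hu : u ∈ Set.extremePoints ℝ (mink F)) :
    polyDeg (mink F) u ≤ r ^ 2 / 4 := by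
  classical
  have hP := aux_convex_mink F
  let G : SimpleGraph (Fin r) := SimpleGraph.fromRel (AuxDir (mink F) u)
  have hG : G.CliqueFree 3 := by
    intro s hs
    obtain ⟨a, b, c, hab, hac, hbc, -⟩ := SimpleGraph.is3Clique_iff.1 hs
    obtain ⟨nab, hab⟩ := (SimpleGraph.fromRel_adj _ _ _).1 hab
    obtain ⟨nac, hac⟩ := (SimpleGraph.fromRel_adj _ _ _).1 hac
    obtain ⟨nbc, hbc⟩ := (SimpleGraph.fromRel_adj _ _ _).1 hbc
    rcases hab with hab | hab <;> rcases hac with hac | hac <;> rcases hbc with hbc | hbc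
    · exact aux_tri hP nab nbc hab hbc hac
    · exact aux_tri hP nac nbc.symm hac hbc hab
    · exact aux_cyc3 hP hab hbc hac
    · exact aux_tri hP nac.symm nab hac hab hbc
    · exact aux_tri hP nab.symm nac hab hac hbc
    · exact aux_cyc3 hP hac hbc hab
    · exact aux_tri hP nbc nac.symm hbc hac hab
    · exact aux_tri hP nbc.symm nab.symm hbc hab hac
  refine le_trans ?_ (aux_mantel G hG)
  have hch : ∀ v : Fin r → ℝ, IsEdgeOf (mink F) u v → ∃ p : Fin r × Fin r,
      p.1 ≠ p.2 ∧ ∃ t : ℝ, 0 < t ∧ v - u = t • (eVec r p.2 - eVec r p.1) := by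
    intro v h
    obtain ⟨a, b, h⟩ := aux_dir h
    exact ⟨(a, b), h⟩
  rcases isEmpty_or_nonempty (Fin r) with hr | hr
  · have : {v | IsEdgeOf (mink F) u v} = ∅ := by
      ext v
      simp only [Set.mem_setOf_eq, Set.mem_empty_iff_false, iff_false]
      exact fun h => h.1 (Subsingleton.elim _ _)
    simp [polyDeg, this]
  choose! f hf using hch
  unfold polyDeg
  refine Set.ncard_le_ncard_of_injOn (fun v => s((f v).1, (f v).2)) ?_ ?_ (Set.toFinite _)
  · intro v hv
    obtain ⟨h1, h2⟩ := hf v hv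
    exact (SimpleGraph.fromRel_adj _ _ _).2 ⟨h1, Or.inl ⟨v, hv, h2⟩⟩
  · intro v hv w hw hvw
    obtain ⟨h1, s, hs, e1⟩ := hf v hv
    obtain ⟨h2, t, ht, e2⟩ := hf w hw
    rcases Sym2.eq_iff.1 hvw with ⟨ha, hb⟩ | ⟨ha, hb⟩
    · rw [← ha, ← hb] at e2
      have q1 := aux_same hu.1 hv.1 hv.2.2.1 hw.2.2.1.1 hs e1 e2
      have q2 := aux_same hu.1 hw.1 hw.2.2.1 hv.2.2.1.1 ht e2 e1
      have q3 : s = t := le_antisymm q2 q1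
      subst q3
      exact sub_left_inj.1 (e1.trans e2.symm)
    · rw [← ha, ← hb] at e2
      exact (aux_cyc2 ⟨v, hv, s, hs, e1⟩ ⟨w, hw, t, ht, e2⟩).elim
end
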